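/- arXiv:2305.08582 — 8 statements merged into one kernel-verified Lean document; each statement's English description precedes it below -/
import Mathlib

section
/- Let X be a nonempty compact metric space, f : X → X a continuous map, and K ⊆ X a subset. Suppose that for every open set U ⊆ X with U ∩ K ≠ ∅ and every N ∈ ℕ, the set ⋃_{n ≥ N} f^{-n}(U) is dense in X. Then the set {x ∈ X : K ⊆ ω(x)} is residual in X (i.e., contains a countable intersection of dense open sets). -/
/-- The ω-limit set of a point `x` under a map `f`:
`ω(x) = ⋂_{N∈ℕ} closure {f^[n] x : n ≥ N}`. -/
def omegaSet {X : Type*} [TopologicalSpace X] (f : X → X) (x : X) : Set X :=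
  ⋂ N : ℕ, closure {y : X | ∃ n : ℕ, N ≤ n ∧ f^[n] x = y}

theorem stmt0 {X : Type*} [MetricSpace X] [CompactSpace X] [Nonempty X]
    (f : X → X) (hf : Continuous f) (K : Set X)
    (h : ∀ U : Set X, IsOpen U → (U ∩ K).Nonempty →
      ∀ N : ℕ, Dense (⋃ n : ℕ, ⋃ _ : N ≤ n, f^[n] ⁻¹' U)) :
    {x : X | K ⊆ omegaSet f x} ∈ residual X := by
  have : SecondCountableTopology X := UniformSpace.secondCountable_of_separable X
  have hres : ∀ᶠ x in residual X, ∀ U ∈ TopologicalSpace.countableBasis X,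
      (U ∩ K).Nonempty → ∀ N : ℕ, ∃ n, N ≤ n ∧ f^[n] x ∈ U := by
    rw [eventually_countable_ball (TopologicalSpace.countable_countableBasis X)]
    intro U hU
    have hUo := TopologicalSpace.isOpen_of_mem_countableBasis hU
    rw [Filter.eventually_imp_distrib_left]
    intro hUK
    rw [eventually_countable_forall]
    intro N
    filter_upwards [residual_of_dense_open
      (isOpen_iUnion fun n => isOpen_iUnion fun _ => hUo.preimage (hf.iterate n))
      (h U hUo hUK N)] with x hx
    simpa using hx
  filter_upwards [hres] with x hx y hy
  refine Set.mem_iInter.2 fun N => ?_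
  rw [(TopologicalSpace.isBasis_countableBasis X).mem_closure_iff]
  intro U hU hyU
  obtain ⟨n, hn, hnU⟩ := hx U hU ⟨y, hyU, hy⟩ N
  exact ⟨f^[n] x, hnU, n, hn, rfl⟩
end

section
/- Let X be a nonempty compact metric space equipped with a finite Borel measure μ, f : X → X a continuous map, and K ⊆ X a subset. Suppose that for every open set U ⊆ X with U ∩ K ≠ ∅ and every N ∈ ℕ, the set ⋃_{n ≥ N} f^{-n}(U) has full μ-measure (its complement is μ-null). Then the set {x ∈ X : K ⊆ ω(x)} has full μ-measure. -/
open TopologicalSpace in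
theorem subset_omegaSet_of_countableBasis {X : Type*} [TopologicalSpace X]
    [SecondCountableTopology X] {f : X → X} {K : Set X} {x : X}
    (hx : ∀ U ∈ countableBasis X, (U ∩ K).Nonempty → ∀ N : ℕ, ∃ n, N ≤ n ∧ f^[n] x ∈ U) :
    K ⊆ omegaSet f x := by
  intro y hy
  refine Set.mem_iInter.2 fun N => (isBasis_countableBasis X).mem_closure_iff.2 fun U hU hyU => ?_
  obtain ⟨n, hn, hnU⟩ := hx U hU ⟨y, hyU, hy⟩ N
  exact ⟨f^[n] x, hnU, n, hn, rfl⟩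

theorem stmt1 {X : Type*} [MetricSpace X] [CompactSpace X] [Nonempty X]
    [MeasurableSpace X] [BorelSpace X]
    (μ : MeasureTheory.Measure X) [MeasureTheory.IsFiniteMeasure μ]
    (f : X → X) (hf : Continuous f) (K : Set X)
    (h : ∀ U : Set X, IsOpen U → (U ∩ K).Nonempty →
      ∀ N : ℕ, μ (⋃ n : ℕ, ⋃ _ : N ≤ n, f^[n] ⁻¹' U)ᶜ = 0) :
    μ {x : X | K ⊆ omegaSet f x}ᶜ = 0 := by
  have key : ∀ᵐ x ∂μ, ∀ U ∈ TopologicalSpace.countableBasis X, (U ∩ K).Nonempty →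
      ∀ N : ℕ, ∃ n, N ≤ n ∧ f^[n] x ∈ U := by
    refine (MeasureTheory.ae_ball_iff (TopologicalSpace.countable_countableBasis X)).2
      fun U hU => ?_
    by_cases hUK : (U ∩ K).Nonempty
    · refine (MeasureTheory.ae_all_iff.2 fun N => ?_).mono fun x hx _ => hx
      have hUN : ∀ᵐ x ∂μ, x ∈ ⋃ n : ℕ, ⋃ _ : N ≤ n, f^[n] ⁻¹' U :=
        MeasureTheory.mem_ae_iff.2 (h U (TopologicalSpace.isOpen_of_mem_countableBasis hU) hUK N)
      simpa using hUN
    · exact .of_forall fun _ hne => absurd hne hUK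
  exact MeasureTheory.mem_ae_iff.1 (key.mono fun _ hx => subset_omegaSet_of_countableBasis hx)
end

section
/- Let X be a compact metric space with a finite Borel measure μ, let Y be a metric space, and let U ⊆ Y be an open set. Then the function Φ : C(X, Y) → ℝ given by Φ(f) = μ(f^{-1}(U)) is lower semicontinuous, where C(X, Y) is the space of continuous maps from X to Y equipped with the topology of uniform convergence (the compact-open topology). -/
theorem stmt3 {X Y : Type*} [MetricSpace X] [CompactSpace X]
    [MeasurableSpace X] [BorelSpace X] [MetricSpace Y]
    (μ : MeasureTheory.Measure X) [MeasureTheory.IsFiniteMeasure μ]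
    (U : Set Y) (hU : IsOpen U) :
    LowerSemicontinuous (fun f : C(X, Y) => (μ (⇑f ⁻¹' U)).toReal) := by
  intro f c hc
  rcases lt_or_ge c 0 with hneg | hpos
  · exact Filter.Eventually.of_forall fun g => hneg.trans_le ENNReal.toReal_nonneg
  · have hlt : ENNReal.ofReal c < μ (⇑f ⁻¹' U) :=
      (ENNReal.ofReal_lt_iff_lt_toReal hpos (MeasureTheory.measure_ne_top μ _)).2 hc
    obtain ⟨K, hKU, hK, hcK⟩ := (hU.preimage f.continuous).exists_lt_isCompact hlt
    filter_upwards [ContinuousMap.eventually_mapsTo hK hU hKU] with g hg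
    exact (ENNReal.ofReal_lt_iff_lt_toReal hpos (MeasureTheory.measure_ne_top μ _)).1
      (hcK.trans_le (MeasureTheory.measure_mono hg))
end

section
/- Let X be a topological space and f : X → X a map with the following property: for every pair of nonempty open sets U, V ⊆ X there exist a point x ∈ X and an integer m ≥ 1 such that f^[m](x) = x and the orbit {f^[k](x) : k ∈ ℕ} intersects both U and V. Then every closed set A ⊆ X with f(A) ⊆ A and nonempty interior satisfies A = X. -/
theorem stmt5 {X : Type*} [TopologicalSpace X] (f : X → X)
    (h : ∀ U V : Set X, IsOpen U → IsOpen V → U.Nonempty → V.Nonempty →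
      ∃ (x : X) (m : ℕ), 1 ≤ m ∧ f^[m] x = x ∧
        (∃ k : ℕ, f^[k] x ∈ U) ∧ (∃ k : ℕ, f^[k] x ∈ V))
    (A : Set X) (hA : IsClosed A) (hinv : f '' A ⊆ A)
    (hint : (interior A).Nonempty) :
    A = Set.univ := by
  by_contra hne
  obtain ⟨x, m, hm, hx, ⟨k, hk⟩, ⟨l, hl⟩⟩ := h (interior A) Aᶜ isOpen_interior
    hA.isOpen_compl hint (Set.nonempty_compl.mpr hne)
  have hmaps : Set.MapsTo f A A := Set.mapsTo_iff_image_subset.mpr hinv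
  have hper : f^[m * k] x = x :=
    (Function.IsPeriodicPt.mul_const (show Function.IsPeriodicPt f m x from hx) k)
  have hle : k ≤ l + m * k := le_add_left (Nat.le_mul_of_pos_left k hm)
  have hmem : f^[l + m * k - k] (f^[k] x) ∈ A :=
    hmaps.iterate _ (interior_subset hk)
  rw [← Function.iterate_add_apply, Nat.sub_add_cancel hle,
    Function.iterate_add_apply, hper] at hmem
  exact hl hmem
end

section
/- Let X be a metric space, f : X → X a continuous map, and D ⊆ X a dense subset such that f is open at every point of D, i.e., for every x ∈ D and every neighborhood V of x, the image f(V) is a neighborhood of f(x). Then for every set A ⊆ X with f(A) ⊆ A, one has f(interior(A)) ⊆ closure(interior(A)). -/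
theorem stmt6 {X : Type*} [MetricSpace X] (f : X → X) (hf : Continuous f)
    (D : Set X) (hD : Dense D)
    (hopen : ∀ x ∈ D, ∀ V ∈ nhds x, f '' V ∈ nhds (f x))
    (A : Set X) (hA : f '' A ⊆ A) :
    f '' interior A ⊆ closure (interior A) := by
  have hmaps : Set.MapsTo f (interior A ∩ D) (interior A) := fun x hx =>
    mem_interior_iff_mem_nhds.2 <|
      Filter.mem_of_superset (hopen x hx.2 A (mem_interior_iff_mem_nhds.1 hx.1)) hA
  rintro _ ⟨x, hx, rfl⟩
  exact hmaps.closure hf (hD.open_subset_closure_inter isOpen_interior hx)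
end

section
/- Let X denote the subspace ([-1,1] ∪ {2}) of ℝ, and let f : X → X be the map defined by f(x) = 2 for x ∈ [-1,1] and f(2) = 0. Then the interior of the set {0, 2} in X equals {2}, and f(2) = 0 does not belong to this interior; consequently f(interior({0,2})) ⊄ interior({0,2}), i.e., the interior of the attractor {0,2} is not invariant under f. -/
/-- The phase space `[-1,1] ∪ {2} ⊆ ℝ`. -/
def Xspace : Set ℝ := Set.Icc (-1) 1 ∪ {2}

/-- The map `f : X → X` with `f(x) = 2` for `x ∈ [-1,1]` and `f(2) = 0`. -/
noncomputable def fmap : Xspace → Xspace := fun x =>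
  if (x : ℝ) = 2 then ⟨0, Or.inl (by norm_num)⟩ else ⟨2, Or.inr rfl⟩

/-- The point `0 ∈ X`. -/
def x0 : Xspace := ⟨0, Or.inl (by norm_num)⟩

/-- The point `2 ∈ X`. -/
def x2 : Xspace := ⟨2, Or.inr rfl⟩

theorem isOpen_singleton_x2 : IsOpen ({x2} : Set Xspace) := by
  refine Metric.isOpen_singleton_iff.2 ⟨1, one_pos, ?_⟩
  rintro ⟨y, hy⟩ h
  rw [Subtype.dist_eq, Real.dist_eq, abs_lt] at h
  simp only [x2] at h
  rcases hy with hy | hy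
  · linarith [hy.2, h.1]
  · exact Subtype.ext hy

theorem x0_notMem_interior : x0 ∉ interior ({x0, x2} : Set Xspace) := by
  intro h
  obtain ⟨ε, hε, hball⟩ := Metric.mem_nhds_iff.1 (mem_interior_iff_mem_nhds.1 h)
  have hpos : 0 < min (ε / 2) 1 := lt_min (half_pos hε) one_pos
  have hle : min (ε / 2) 1 ≤ 1 := min_le_right _ _
  have hlt : min (ε / 2) 1 < ε := (min_le_left _ _).trans_lt (half_lt_self hε)
  have hmem : (⟨min (ε / 2) 1, Or.inl ⟨by linarith, hle⟩⟩ : Xspace) ∈ Metric.ball x0 ε := by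
    rw [Metric.mem_ball, Subtype.dist_eq, Real.dist_eq]
    simpa only [x0, sub_zero, abs_of_pos hpos] using hlt
  rcases hball hmem with h0 | h2
  · exact hpos.ne' (congrArg Subtype.val h0)
  · have : min (ε / 2) 1 = 2 := congrArg Subtype.val h2
    linarith

theorem fmap_x2 : fmap x2 = x0 := if_pos rfl

theorem interior_pair : interior ({x0, x2} : Set Xspace) = {x2} := by
  apply Set.Subset.antisymm
  · intro y hy
    rcases interior_subset hy with rfl | h
    · exact absurd hy x0_notMem_interior
    · exact h
  · exact interior_maximal (by simp) isOpen_singleton_x2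

theorem stmt11 :
    interior ({x0, x2} : Set Xspace) = {x2} ∧
    fmap x2 = x0 ∧
    fmap x2 ∉ interior ({x0, x2} : Set Xspace) ∧
    ¬ (fmap '' interior ({x0, x2} : Set Xspace) ⊆ interior ({x0, x2} : Set Xspace)) := by
  refine ⟨interior_pair, fmap_x2, fmap_x2 ▸ x0_notMem_interior, fun h => ?_⟩
  have hx2 : x2 ∈ interior ({x0, x2} : Set Xspace) := interior_pair.symm.subset rfl
  exact x0_notMem_interior (h ⟨x2, hx2, fmap_x2⟩)
end

section
/- Let X denote the subspace ([-1,1] ∪ {2}) of ℝ, and let f : X → X be the map defined by f(x) = 2 for x ∈ [-1,1] and f(2) = 0. Let g : X → X be any continuous map satisfying |g(x) − f(x)| < 1/4 for all x ∈ X. Then: (i) for every x ∈ X, the ω-limit set of x under g equals {2, g(2)}; (ii) the interior of {2, g(2)} in X equals {2}; and (iii) g(2) ∉ interior({2, g(2)}), so g(interior({2, g(2)})) ⊄ interior({2, g(2)}), i.e., the interior of the attractor of g is not invariant. -/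
theorem Xspace.val_le_one_of_ne {x : Xspace} (hx : (x : ℝ) ≠ 2) : (x : ℝ) ≤ 1 := by
  rcases x.2 with h | h
  · exact h.2
  · exact absurd h hx

/-- A finite set has no interior point in the interval part `[-1, 1)` of the phase space. -/
theorem notMem_interior_of_finite {s : Set Xspace} (hs : s.Finite) {p : Xspace}
    (hp : (p : ℝ) < 1) : p ∉ interior s := by
  intro h
  obtain ⟨ε, hε, hball⟩ := Metric.mem_nhds_iff.1 (mem_interior_iff_mem_nhds.1 h)
  have hp' : -1 ≤ (p : ℝ) := by
    rcases p.2 with h | h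
    · exact h.1
    · have h2 : (p : ℝ) = 2 := h
      linarith
  refine (Set.Ioo_infinite (lt_min hp (lt_add_of_pos_right (p : ℝ) hε))) ?_
  refine (hs.image Subtype.val).subset fun t ht => ?_
  obtain ⟨h1, h2⟩ := ht
  obtain ⟨h2, h3⟩ := lt_min_iff.1 h2
  refine ⟨⟨t, Or.inl ⟨by linarith, h2.le⟩⟩, hball ?_, rfl⟩
  rw [Metric.mem_ball, Subtype.dist_eq, Real.dist_eq, abs_lt]
  constructor <;> dsimp only <;> linarith

/-- If `g` sends every point other than `a` to `a`, then every ω-limit set is `{a, g a}`. -/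
theorem omegaSet_eq_pair {X : Type*} [TopologicalSpace X] [T1Space X] {g : X → X} {a : X}
    (hne : ∀ y, y ≠ a → g y = a) (x : X) : omegaSet g x = {a, g a} := by
  have hvisit : ∀ N, ∃ n, N ≤ n ∧ g^[n] x = a := fun N => by
    by_cases h : g^[N] x = a
    · exact ⟨N, le_rfl, h⟩
    · exact ⟨N + 1, N.le_succ, by rw [Function.iterate_succ_apply', hne _ h]⟩
  apply Set.Subset.antisymm
  · refine (Set.iInter_subset _ 1).trans (closure_minimal ?_ (Set.toFinite _).isClosed)
    rintro y ⟨n, hn, rfl⟩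
    obtain ⟨m, rfl⟩ := Nat.exists_eq_add_of_le' hn
    rw [Function.iterate_succ_apply']
    by_cases h : g^[m] x = a
    · right
      rw [h, Set.mem_singleton_iff]
    · left
      exact hne _ h
  · rintro y (rfl | rfl) <;> refine Set.mem_iInter.2 fun N => subset_closure ?_
    · exact hvisit N
    · obtain ⟨n, hn, h⟩ := hvisit N
      exact ⟨n + 1, by omega, by rw [Function.iterate_succ_apply', h]⟩

theorem stmt13 (g : Xspace → Xspace) (hg : Continuous g)
    (hclose : ∀ x : Xspace, |(g x : ℝ) - (fmap x : ℝ)| < 1 / 4) :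
    (∀ x : Xspace, omegaSet g x = {x2, g x2}) ∧
    interior ({x2, g x2} : Set Xspace) = {x2} ∧
    g x2 ∉ interior ({x2, g x2} : Set Xspace) ∧
    ¬ (g '' interior ({x2, g x2} : Set Xspace) ⊆ interior ({x2, g x2} : Set Xspace)) := by
  have hne : ∀ y, y ≠ x2 → g y = x2 := fun y hy => by
    have hy2 : (y : ℝ) ≠ 2 := fun h => hy (Subtype.ext h)
    have h := hclose y
    rw [fmap, if_neg hy2, abs_lt] at h
    by_contra hg2
    have := Xspace.val_le_one_of_ne (x := g y) fun h => hg2 (Subtype.ext h)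
    have := h.1
    dsimp only at this
    linarith
  have hlt : (g x2 : ℝ) < 1 := by
    have h := hclose x2
    rw [fmap, if_pos (show (x2 : ℝ) = 2 from rfl), abs_lt] at h
    have := h.2
    dsimp only at this
    linarith
  have hnot : g x2 ∉ interior ({x2, g x2} : Set Xspace) :=
    notMem_interior_of_finite (Set.toFinite _) hlt
  have hint : interior ({x2, g x2} : Set Xspace) = {x2} := by
    apply Set.Subset.antisymm
    · intro y hy
      rcases interior_subset hy with h | rfl
      · exact h
      · exact absurd hy hnot
    · exact interior_maximal (by simp) isOpen_singleton_x2
  refine ⟨omegaSet_eq_pair hne, hint, hnot, fun h => hnot (h ⟨x2, ?_, rfl⟩)⟩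
  rw [hint]
  exact Set.mem_singleton x2
end

section
/- Let d ≥ 2 be a natural number and let f : ℝ/ℤ → ℝ/ℤ be the expanding circle map f(θ) = d·θ. Then for every pair of nonempty open sets U, V ⊆ ℝ/ℤ there exist a point x ∈ ℝ/ℤ and an integer m ≥ 1 such that f^[m](x) = x, and there exist k₁, k₂ ∈ ℕ with f^[k₁](x) ∈ U and f^[k₂](x) ∈ V; that is, any two nonempty open sets are connected by a periodic orbit of f. -/
/-- A nonempty open subset of the circle contains an interval around some point of `[0, 1)`. -/
lemma AddCircle.exists_ball_subset_preimage {U : Set (AddCircle (1 : ℝ))} (hU : IsOpen U)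
    (hne : U.Nonempty) :
    ∃ u ∈ Set.Ico (0 : ℝ) 1, ∃ ε > 0, ∀ x : ℝ, |x - u| < ε → (x : AddCircle (1 : ℝ)) ∈ U := by
  obtain ⟨p, hp⟩ := hne
  obtain ⟨r, rfl⟩ := QuotientAddGroup.mk_surjective p
  have hfract : ((Int.fract r : ℝ) : AddCircle (1 : ℝ)) = r := by
    rw [← sub_eq_zero, ← AddCircle.coe_sub, AddCircle.coe_eq_zero_iff]
    exact ⟨-⌊r⌋, by simp [← Int.self_sub_floor]⟩
  have hopen : IsOpen ((fun x : ℝ => (x : AddCircle (1 : ℝ))) ⁻¹' U) :=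
    hU.preimage (AddCircle.continuous_mk' 1)
  obtain ⟨ε, hε, hball⟩ := Metric.isOpen_iff.1 hopen (Int.fract r) (by
    rw [Set.mem_preimage, hfract]; exact hp)
  exact ⟨Int.fract r, ⟨Int.fract_nonneg r, Int.fract_lt_one r⟩, ε, hε, fun x hx =>
    hball (by rwa [Metric.mem_ball, Real.dist_eq])⟩

/-- The number whose base-`D` expansion is the repeating block `⌊D u⌋ ⌊D v⌋` is close to `u`. -/
lemma abs_repeating_block_sub_le {D : ℕ} (hD : 2 ≤ D) {u v : ℝ} (hu : u ∈ Set.Ico (0 : ℝ) 1)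
    (hv : v ∈ Set.Ico (0 : ℝ) 1) :
    |(⌊D * u⌋₊ * D + ⌊D * v⌋₊ : ℝ) / ((D : ℝ) ^ 2 - 1) - u| ≤ 1 / (D : ℝ) := by
  have hD' : (2 : ℝ) ≤ D := by exact_mod_cast hD
  have digit_le {w : ℝ} (hw : w ∈ Set.Ico (0 : ℝ) 1) : (⌊D * w⌋₊ : ℝ) ≤ D - 1 := by
    have h : ⌊D * w⌋₊ < D :=
      (Nat.floor_lt (mul_nonneg (by linarith) hw.1)).2 (by nlinarith [hw.2])
    have : ((⌊D * w⌋₊ + 1 : ℕ) : ℝ) ≤ D := by exact_mod_cast h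
    push_cast at this
    linarith
  have ha := digit_le hu
  have hb := digit_le hv
  have hfloor := Nat.floor_le (mul_nonneg (by linarith : (0 : ℝ) ≤ D) hu.1)
  have hlt := Nat.lt_floor_add_one ((D : ℝ) * u)
  have ha0 : (0 : ℝ) ≤ ⌊D * u⌋₊ := Nat.cast_nonneg _
  have hb0 : (0 : ℝ) ≤ ⌊D * v⌋₊ := Nat.cast_nonneg _
  generalize (⌊D * u⌋₊ : ℝ) = a at *
  generalize (⌊D * v⌋₊ : ℝ) = b at *
  have hpos : (0 : ℝ) < D ^ 2 - 1 := by nlinarith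
  have hD0 : (0 : ℝ) < D := by linarith
  have hsplit : (a * D + b) / ((D : ℝ) ^ 2 - 1) - u =
      ((b * D + a) / ((D : ℝ) ^ 2 - 1) - (D * u - a)) / D := by
    field_simp
    ring
  have h0 : 0 ≤ (b * D + a) / ((D : ℝ) ^ 2 - 1) := by positivity
  have h1 : (b * D + a) / ((D : ℝ) ^ 2 - 1) ≤ 1 := by
    rw [div_le_one hpos]
    nlinarith
  rw [hsplit, abs_div, abs_of_pos hD0]
  gcongr
  rw [abs_le]
  constructor <;> linarith

/-- Multiplication by `D` on the circle swaps the two digits of a repeating block of length two. -/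
lemma AddCircle.nsmul_repeating_block {D : ℕ} (hD : 2 ≤ D) (a b : ℕ) :
    D • (((a * D + b : ℝ) / (D ^ 2 - 1) : ℝ) : AddCircle (1 : ℝ)) =
      (((b * D + a : ℝ) / (D ^ 2 - 1) : ℝ) : AddCircle (1 : ℝ)) := by
  have hD' : (2 : ℝ) ≤ D := by exact_mod_cast hD
  have hne : (D : ℝ) ^ 2 - 1 ≠ 0 := by nlinarith
  have h : D • ((a * D + b : ℝ) / (D ^ 2 - 1)) = (b * D + a : ℝ) / (D ^ 2 - 1) + a • (1 : ℝ) := by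
    rw [nsmul_eq_mul, nsmul_eq_mul]
    field_simp
    ring
  rw [← AddCircle.coe_nsmul, h, AddCircle.coe_add, AddCircle.coe_nsmul, AddCircle.coe_period,
    nsmul_zero, add_zero]

theorem stmt16 (d : ℕ) (hd : 2 ≤ d) (U V : Set (AddCircle (1 : ℝ)))
    (hU : IsOpen U) (hV : IsOpen V) (hUne : U.Nonempty) (hVne : V.Nonempty) :
    ∃ (x : AddCircle (1 : ℝ)) (m : ℕ), 1 ≤ m ∧
      (fun θ : AddCircle (1 : ℝ) => d • θ)^[m] x = x ∧
      (∃ k₁ : ℕ, (fun θ : AddCircle (1 : ℝ) => d • θ)^[k₁] x ∈ U) ∧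
      (∃ k₂ : ℕ, (fun θ : AddCircle (1 : ℝ) => d • θ)^[k₂] x ∈ V) := by
  obtain ⟨u, hu, ε, hε, hUε⟩ := AddCircle.exists_ball_subset_preimage hU hUne
  obtain ⟨v, hv, δ, hδ, hVδ⟩ := AddCircle.exists_ball_subset_preimage hV hVne
  have hd' : (1 : ℝ) < d := by exact_mod_cast hd
  obtain ⟨n, hn⟩ := exists_pow_lt_of_lt_one (lt_min hε hδ) (inv_lt_one_of_one_lt₀ hd')
  have hsmall : 1 / ((d ^ (n + 1) : ℕ) : ℝ) < min ε δ := by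
    refine lt_of_le_of_lt ?_ hn
    rw [inv_pow, one_div, Nat.cast_pow]
    gcongr
    · exact hd'.le
    · exact n.le_succ
  have hD : 2 ≤ d ^ (n + 1) := hd.trans (Nat.le_self_pow n.succ_ne_zero d)
  have hiter : (fun θ : AddCircle (1 : ℝ) => d • θ)^[n + 1] = fun θ => d ^ (n + 1) • θ :=
    smul_iterate d (n + 1)
  have hxU := hUε _ ((abs_repeating_block_sub_le hD hu hv).trans_lt
    (hsmall.trans_le (min_le_left _ _)))
  have hyV := hVδ _ ((abs_repeating_block_sub_le hD hv hu).trans_lt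
    (hsmall.trans_le (min_le_right _ _)))
  have hxy := AddCircle.nsmul_repeating_block hD ⌊(d ^ (n + 1) : ℕ) * u⌋₊ ⌊(d ^ (n + 1) : ℕ) * v⌋₊
  have hyx := AddCircle.nsmul_repeating_block hD ⌊(d ^ (n + 1) : ℕ) * v⌋₊ ⌊(d ^ (n + 1) : ℕ) * u⌋₊
  generalize ((_ : ℝ) : AddCircle (1 : ℝ)) = x at hxU hxy hyx
  generalize ((_ : ℝ) : AddCircle (1 : ℝ)) = y at hyV hxy hyx
  refine ⟨x, (n + 1) + (n + 1), by omega, ?_, ⟨0, hxU⟩, ⟨n + 1, ?_⟩⟩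
  · rw [Function.iterate_add_apply, hiter]
    dsimp only
    rw [hxy, hyx]
  · rw [hiter]
    dsimp only
    rwa [hxy]
end
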